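/- arXiv:2302.01900 — 5 statements merged into one kernel-verified Lean document; each statement's English description precedes it below -/
import Mathlib

section
/- Let b ≥ 2 be an integer, let j be an integer with 0 ≤ j < b, and let n be a nonnegative integer. Then the (finite-support) sum ∑_{k≥1} ⌊(n + j·b^{k−1}) / b^k⌋ equals (n − s_b(n))/(b−1) + λ'_{b−j}(n). (All terms with b^{k−1} > n and j·b^{k-1} + n < b^k vanish, so the sum equals the finite sum over 1 ≤ k ≤ ⌊log_b n⌋ + 1 when n ≥ 1, and for j = 0 the term λ'_b(n) is interpreted as 0.) -/
/-- The sum of the `b`-ary digits of `n`. -/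
def digitSum (b n : ℕ) : ℕ := (Nat.digits b n).sum

/-- `conjPart b n i` is `λ'_i(n)`: the number of `b`-ary digits of `n` that are `≥ i`
(the `i`-th part of the conjugate of the partition formed by the digits). -/
def conjPart (b n i : ℕ) : ℕ := ((Nat.digits b n).filter (fun c => i ≤ c)).length

lemma add_mul_pow_succ_div (b j n k : ℕ) (hb : 0 < b) :
    (n + j * b ^ (k + 1)) / b ^ (k + 1 + 1) = (n / b + j * b ^ k) / b ^ (k + 1) := by
  rw [pow_succ' b (k + 1), ← Nat.div_div_eq_div_mul, pow_succ b k, ← mul_assoc,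
    Nat.add_mul_div_right _ _ hb]

lemma add_div_eq_div_add_ite (b j n : ℕ) (hj : j < b) :
    (n + j) / b = n / b + if b - j ≤ n % b then 1 else 0 := by
  have hb : 0 < b := by omega
  rw [Nat.add_div hb, Nat.div_eq_of_lt hj, Nat.mod_eq_of_lt hj, add_zero]
  congr 1
  exact if_congr (by omega) rfl rfl

lemma conjPart_eq_conjPart_div_add (b n i : ℕ) (hb : 1 < b) (hn : 0 < n) :
    conjPart b n i = conjPart b (n / b) i + if i ≤ n % b then 1 else 0 := by
  unfold conjPart
  rw [Nat.digits_def' hb hn, List.filter_cons]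
  split_ifs <;> simp_all

lemma sub_digitSum_div_eq (b n : ℕ) (hb : 1 < b) (hn : 0 < n) :
    (n - digitSum b n) / (b - 1) = n / b + (n / b - digitSum b (n / b)) / (b - 1) := by
  have hs : digitSum b n = n % b + digitSum b (n / b) := by
    simp [digitSum, Nat.digits_def' hb hn]
  have hle : digitSum b (n / b) ≤ n / b := Nat.digit_sum_le b (n / b)
  have key : n - digitSum b n = n / b - digitSum b (n / b) + (b - 1) * (n / b) := by
    have hdiv := Nat.mod_add_div n b
    have hmul : b * (n / b) = (b - 1) * (n / b) + n / b := by
      rw [← Nat.succ_mul, Nat.succ_eq_add_one, Nat.sub_add_cancel hb.le]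
    omega
  rw [key, Nat.add_mul_div_left _ _ (by omega), add_comm]

/-- The sum of `⌊(n + j·b^(k-1)) / b^k⌋` over `k ≥ 1` (reindexed by `k ↦ k+1`) converges. -/
theorem hasSum_add_mul_pow_div (b j n : ℕ) (hb : 2 ≤ b) (hj : j < b) :
    HasSum (fun k : ℕ => (n + j * b ^ k) / b ^ (k + 1))
      ((n - digitSum b n) / (b - 1) + conjPart b n (b - j)) := by
  induction n using Nat.strong_induction_on with
  | _ n ih =>
    rcases Nat.eq_zero_or_pos n with rfl | hn
    · have hzero (k : ℕ) : (0 + j * b ^ k) / b ^ (k + 1) = 0 := by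
        rw [zero_add, pow_succ']
        exact Nat.div_eq_of_lt (Nat.mul_lt_mul_of_pos_right hj (by positivity))
      simpa only [hzero, digitSum, conjPart, Nat.digits_zero, List.sum_nil, List.filter_nil,
        List.length_nil, Nat.zero_sub, Nat.zero_div, add_zero] using
          (hasSum_zero : HasSum (fun _ : ℕ => (0 : ℕ)) 0)
    · have htail := ih (n / b) (Nat.div_lt_self hn hb)
      simp only [← add_mul_pow_succ_div b j n _ (by omega)] at htail
      have h := HasSum.zero_add (f := fun k : ℕ => (n + j * b ^ k) / b ^ (k + 1)) htail
      convert h using 1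
      simp only [pow_zero, mul_one, zero_add, pow_one]
      rw [add_div_eq_div_add_ite b j n hj, sub_digitSum_div_eq b n hb hn,
        conjPart_eq_conjPart_div_add b n _ hb hn]
      ring

/-- For an integer base `b ≥ 2`, an integer `0 ≤ j < b` and a nonnegative integer `n`,
the finite-support sum `∑_{k≥1} ⌊(n + j·b^(k-1)) / b^k⌋` (reindexed by `k ↦ k+1`, with
floors of nonnegative quotients expressed as natural division) equals
`(n − s_b(n))/(b−1) + λ'_{b−j}(n)`. -/
theorem floor_single_sum (b j n : ℕ) (hb : 2 ≤ b) (hj : j < b) :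
    ∑' k : ℕ, (n + j * b ^ k) / b ^ (k + 1) =
      (n - digitSum b n) / (b - 1) + conjPart b n (b - j) :=
  (hasSum_add_mul_pow_div b j n hb hj).tsum_eq
end

section
/- Let b ≥ 2 be an integer, let j be an integer with 1 ≤ j ≤ b−1, and let n ≥ 1 be an integer with m = ⌊log_b n⌋. Then ∑_{k=0}^{m} ⌈(n + j·b^k) / b^{k+1}⌉ = (n − s_b(n))/(b−1) + m + λ'_{b−j}(n) + [c_{ν_b(n)} ≠ b−j], where c_{ν_b(n)} = ⌊n / b^{ν_b(n)}⌋ mod b is the lowest nonzero b-ary digit of n. -/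
/-- Counting the entries of a list that satisfy `p` amounts to summing indicators over indices. -/
theorem List.length_filter_eq_sum_range (p : ℕ → Prop) [DecidablePred p] (l : List ℕ) :
    (l.filter (fun c => p c)).length =
      ∑ k ∈ Finset.range l.length, if p (l.getD k 0) then 1 else 0 := by
  induction l with
  | nil => simp
  | cons a l ih =>
    rw [List.length_cons, Finset.sum_range_succ']
    simp only [List.getD_cons_succ, List.getD_cons_zero, ← ih, List.filter_cons]
    split_ifs <;> simp_all

theorem conjPart_eq_sum {b n : ℕ} (hb : 2 ≤ b) (hn : n ≠ 0) (i : ℕ) :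
    conjPart b n i =
      ∑ k ∈ Finset.range (Nat.log b n + 1), if i ≤ n / b ^ k % b then 1 else 0 := by
  rw [conjPart, List.length_filter_eq_sum_range (fun c => i ≤ c), Nat.length_digits b n hb hn]
  simp only [Nat.getD_digits n _ hb]

theorem eq_padicValNat_iff {b n : ℕ} (hb : 2 ≤ b) (hn : n ≠ 0) (k : ℕ) :
    k = padicValNat b n ↔ n % b ^ k = 0 ∧ n / b ^ k % b ≠ 0 := by
  have hf : FiniteMultiplicity b n :=
    Nat.finiteMultiplicity_iff.2 ⟨by omega, Nat.pos_of_ne_zero hn⟩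
  rw [padicValNat_def' (by omega) hn, eq_comm, hf.multiplicity_eq_iff, ← Nat.dvd_iff_mod_eq_zero]
  refine and_congr_right fun h => not_congr ?_
  rw [← Nat.dvd_iff_mod_eq_zero, pow_succ, Nat.dvd_div_iff_mul_dvd h]

theorem padicValNat_le_log {b n : ℕ} (hb : 2 ≤ b) (hn : n ≠ 0) :
    padicValNat b n ≤ Nat.log b n := by
  refine Nat.le_log_of_pow_le hb (Nat.le_of_dvd (Nat.pos_of_ne_zero hn) ?_)
  exact Nat.dvd_of_mod_eq_zero ((eq_padicValNat_iff hb hn _).1 rfl).1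

/-- The ceiling of `(n + j * b ^ k) / b ^ (k + 1)` in terms of the `k`-th digit of `n`. -/
theorem ceil_add_mul_pow_div_pow_succ {b j : ℕ} (n k : ℕ) (hb : 2 ≤ b) (hj1 : 1 ≤ j)
    (hj2 : j ≤ b - 1) :
    ⌈((n : ℚ) + j * b ^ k) / b ^ (k + 1)⌉ =
      (n / b ^ (k + 1) : ℕ) + 1 + (if b - j ≤ n / b ^ k % b then 1 else 0)
        - (if n % b ^ k = 0 ∧ n / b ^ k % b = b - j then 1 else 0) := by
  have hB : 0 < b ^ k := by positivity
  have h1 : b ^ k * (n / b ^ k) + n % b ^ k = n := Nat.div_add_mod _ _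
  have h2 : b * (n / b ^ k / b) + n / b ^ k % b = n / b ^ k := Nat.div_add_mod _ _
  have hr : n % b ^ k < b ^ k := Nat.mod_lt _ hB
  have hc : n / b ^ k % b < b := Nat.mod_lt _ (by omega)
  rw [pow_succ b k, ← Nat.div_div_eq_div_mul, Int.ceil_eq_iff,
    lt_div_iff₀ (by positivity), div_le_iff₀ (by positivity)]
  generalize n / b ^ k / b = q at *
  generalize n / b ^ k % b = c at *
  generalize n % b ^ k = r at *
  rw [← h2] at h1
  obtain ⟨i, rfl⟩ : ∃ i, b = i + j := ⟨b - j, by omega⟩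
  rw [pow_succ]
  have hn : (n : ℚ) = ((i + j : ℕ) : ℚ) ^ k * ((i + j : ℕ) * q + c) + r := by
    rw [← h1]; push_cast; ring
  rw [← Nat.cast_pow] at hn ⊢
  generalize (i + j) ^ k = B at *
  rw [hn]
  simp only [Nat.add_sub_cancel]
  have hBq : (0 : ℚ) < B := by exact_mod_cast hB
  have hrq : (r : ℚ) + 1 ≤ B := by exact_mod_cast hr
  have hr0 : (0 : ℚ) ≤ r := by positivity
  have hj : (1 : ℚ) ≤ j := by exact_mod_cast hj1
  have hcq : (c : ℚ) + 1 ≤ i + j := by exact_mod_cast hc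
  have hi : (1 : ℚ) ≤ i := by exact_mod_cast (by omega : 1 ≤ i)
  have hc0 : (0 : ℚ) ≤ c := by positivity
  push_cast
  by_cases h : i ≤ c
  · have hic : (i : ℚ) ≤ c := by exact_mod_cast h
    by_cases h' : r = 0 ∧ c = i
    · obtain ⟨rfl, rfl⟩ := h'
      simp only [le_refl, and_self, if_true]
      push_cast
      constructor <;> nlinarith
    · simp only [h, h', if_true, if_false]
      refine ⟨?_, by nlinarith⟩
      have : (1 : ℚ) ≤ B * (c - i) + r := by
        rcases h.eq_or_lt with rfl | hlt
        · have : (1 : ℚ) ≤ r := by exact_mod_cast (by omega : 1 ≤ r)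
          linarith
        · have : (i : ℚ) + 1 ≤ c := by exact_mod_cast hlt
          nlinarith
      nlinarith
  · have hic : (c : ℚ) + 1 ≤ i := by exact_mod_cast not_le.1 h
    have h' : ¬ (r = 0 ∧ c = i) := by omega
    simp only [h, h', if_false]
    constructor <;> nlinarith

/-- For a base `b ≥ 2`, an integer `1 ≤ j ≤ b-1` and an integer `n ≥ 1` with
`m = ⌊log_b n⌋`, we have
`∑_{k=0}^{m} ⌈(n + j·b^k)/b^(k+1)⌉
  = (n − s_b(n))/(b−1) + m + λ'_{b−j}(n) + [c_{ν_b(n)} ≠ b−j]`,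
where `c_{ν_b(n)} = ⌊n/b^(ν_b(n))⌋ mod b` is the lowest nonzero `b`-ary digit of `n`. -/
theorem ceil_single_sum (b j n : ℕ) (hb : 2 ≤ b) (hj1 : 1 ≤ j) (hj2 : j ≤ b - 1)
    (hn : 1 ≤ n) :
    ∑ k ∈ Finset.range (Nat.log b n + 1), ⌈((n : ℚ) + j * b ^ k) / b ^ (k + 1)⌉ =
      (((n - digitSum b n) / (b - 1) + Nat.log b n + conjPart b n (b - j)
        + if n / b ^ (padicValNat b n) % b ≠ b - j then 1 else 0 : ℕ) : ℤ) := by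
  have hn0 : n ≠ 0 := by omega
  have hdiv : (n - digitSum b n) / (b - 1) =
      ∑ k ∈ Finset.range (Nat.log b n + 1), n / b ^ (k + 1) := by
    rw [digitSum, ← Nat.sub_one_mul_sum_log_div_pow_eq_sub_sum_digits n]
    exact Nat.mul_div_cancel_left _ (by omega)
  have hind : ∀ k, (n % b ^ k = 0 ∧ n / b ^ k % b = b - j) ↔
      k = padicValNat b n ∧ n / b ^ padicValNat b n % b = b - j := by
    intro k
    constructor
    · rintro ⟨h1, h2⟩
      have hk := (eq_padicValNat_iff hb hn0 k).2 ⟨h1, by omega⟩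
      exact ⟨hk, hk ▸ h2⟩
    · rintro ⟨hk, h⟩
      exact ⟨((eq_padicValNat_iff hb hn0 k).1 hk).1, hk ▸ h⟩
  have hmem : padicValNat b n ∈ Finset.range (Nat.log b n + 1) :=
    Finset.mem_range_succ_iff.2 (padicValNat_le_log hb hn0)
  rw [hdiv, conjPart_eq_sum hb hn0]
  simp only [ceil_add_mul_pow_div_pow_succ n _ hb hj1 hj2, hind, ite_and,
    Finset.sum_sub_distrib, Finset.sum_add_distrib, Finset.sum_ite_eq', hmem, if_true]
  push_cast
  simp only [Finset.sum_const, Finset.card_range, nsmul_eq_mul]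
  push_cast
  split_ifs <;> first | contradiction | ring
end

section
/- Let b ≥ 2 be an integer and let x ≥ 1 be a real number. Then ∑_{k=0}^{⌊log_b x⌋} ∑_{j=1}^{b−1} ⌈(x + j·b^k) / b^{k+1}⌉ = (b−1)(⌊log_b x⌋ + 1) + ⌈x⌉ − 1. -/
/-- Adding an integer and dividing by a positive natural number commutes with an inner ceiling. -/
theorem ceil_add_natCast_div (b : ℕ) (hb : 0 < b) (y : ℝ) (j : ℕ) :
    ⌈(y + j) / b⌉ = ⌈((⌈y⌉ : ℝ) + j) / b⌉ := by
  have hb' : (0 : ℝ) < b := by exact_mod_cast hb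
  refine eq_of_forall_ge_iff fun c => ?_
  have h : y ≤ ((c * b - j : ℤ) : ℝ) ↔ (⌈y⌉ : ℝ) ≤ ((c * b - j : ℤ) : ℝ) := by
    rw [← Int.ceil_le, Int.cast_le]
  push_cast at h
  rw [Int.ceil_le, Int.ceil_le, div_le_iff₀ hb', div_le_iff₀ hb', ← le_sub_iff_add_le,
    ← le_sub_iff_add_le, h]

theorem sum_ceil_intCast_add_div_succ (b : ℕ) (hb : 0 < b) (m : ℤ) :
    ∑ j ∈ Finset.range b, ⌈(((m + 1 : ℤ) : ℝ) + j) / b⌉ =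
      ∑ j ∈ Finset.range b, ⌈((m : ℝ) + j) / b⌉ + 1 := by
  have hb' : (b : ℝ) ≠ 0 := by exact_mod_cast hb.ne'
  have h := (Finset.sum_range_succ' (fun j : ℕ => ⌈((m : ℝ) + j) / b⌉) b).symm.trans
    (Finset.sum_range_succ _ b)
  rw [add_div (m : ℝ) (b : ℝ), div_self hb', Int.ceil_add_one] at h
  have e : ∑ j ∈ Finset.range b, ⌈(((m + 1 : ℤ) : ℝ) + j) / b⌉ =
      ∑ j ∈ Finset.range b, ⌈((m : ℝ) + (j + 1 : ℕ)) / b⌉ := by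
    refine Finset.sum_congr rfl fun j _ => ?_
    push_cast
    congr 2
    ring
  rw [e]
  simp only [Nat.cast_zero, add_zero] at h
  linarith

theorem sum_ceil_natCast_div (b : ℕ) (hb : 0 < b) :
    ∑ j ∈ Finset.range b, ⌈(j : ℝ) / b⌉ = (b : ℤ) - 1 := by
  obtain ⟨n, rfl⟩ := Nat.exists_eq_succ_of_ne_zero hb.ne'
  rw [Finset.sum_range_succ']
  have h : ∀ j ∈ Finset.range n, ⌈((j + 1 : ℕ) : ℝ) / (n.succ : ℕ)⌉ = 1 := by
    intro j hj
    have hj' : ((j + 1 : ℕ) : ℝ) ≤ (n.succ : ℕ) := by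
      exact_mod_cast Nat.succ_le_succ (Finset.mem_range.mp hj).le
    rw [Int.ceil_eq_iff]
    refine ⟨?_, ?_⟩
    · have : (0 : ℝ) < ((j + 1 : ℕ) : ℝ) / (n.succ : ℕ) := by positivity
      simpa using this
    · rw [Int.cast_one]
      exact div_le_one_of_le₀ hj' (by positivity)
  rw [Finset.sum_congr rfl h]
  simp

/-- Hermite's identity for ceilings. -/
theorem sum_ceil_add_natCast_div (b : ℕ) (hb : 0 < b) (y : ℝ) :
    ∑ j ∈ Finset.range b, ⌈(y + j) / b⌉ = ⌈y⌉ + b - 1 := by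
  have key (m : ℤ) : ∑ j ∈ Finset.range b, ⌈((m : ℝ) + j) / b⌉ = m + b - 1 := by
    induction m using Int.induction_on with
    | zero => simpa using sum_ceil_natCast_div b hb
    | succ i ih => rw [sum_ceil_intCast_add_div_succ b hb, ih]; ring
    | pred i ih =>
      have h := sum_ceil_intCast_add_div_succ b hb (-(i : ℤ) - 1)
      rw [sub_add_cancel, ih] at h
      linarith
  rw [← key ⌈y⌉]
  exact Finset.sum_congr rfl fun j _ => ceil_add_natCast_div b hb y j

theorem sum_Ico_ceil_add_mul_pow_div (b : ℕ) (hb : 0 < b) (x : ℝ) (k : ℕ) :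
    ∑ j ∈ Finset.Ico 1 b, ⌈(x + j * (b : ℝ) ^ k) / b ^ (k + 1)⌉ =
      ((b : ℤ) - 1) + (⌈x / (b : ℝ) ^ k⌉ - ⌈x / (b : ℝ) ^ (k + 1)⌉) := by
  have hb' : (b : ℝ) ≠ 0 := by exact_mod_cast hb.ne'
  have h := sum_ceil_add_natCast_div b hb (x / (b : ℝ) ^ k)
  have e (j : ℕ) : (x / (b : ℝ) ^ k + j) / b = (x + j * (b : ℝ) ^ k) / b ^ (k + 1) := by
    field_simp
    ring
  simp only [e] at h
  rw [Finset.range_eq_Ico, Finset.sum_eq_sum_Ico_succ_bot hb] at h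
  simp only [Nat.cast_zero, zero_mul, add_zero, zero_add] at h
  linarith

/-- For an integer base `b ≥ 2` and a real `x ≥ 1`,
`∑_{k=0}^{⌊log_b x⌋} ∑_{j=1}^{b-1} ⌈(x + j·b^k)/b^(k+1)⌉
  = (b−1)(⌊log_b x⌋ + 1) + ⌈x⌉ − 1`. -/
theorem ceil_double_sum_real (b : ℕ) (hb : 2 ≤ b) (x : ℝ) (hx : 1 ≤ x) :
    ∑ k ∈ Finset.range (⌊Real.logb b x⌋.toNat + 1), ∑ j ∈ Finset.Ico 1 b,
        ⌈(x + j * (b : ℝ) ^ k) / b ^ (k + 1)⌉ =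
      ((b : ℤ) - 1) * (⌊Real.logb b x⌋ + 1) + ⌈x⌉ - 1 := by
  have hb0 : (0 : ℝ) < b := by exact_mod_cast (by omega : 0 < b)
  have hx0 : 0 < x := by linarith
  obtain ⟨n, hn⟩ : ∃ n : ℕ, ⌊Real.logb b x⌋ = n := by
    rw [Real.floor_logb_natCast hx0.le, Int.log_of_one_le_right b hx]
    exact ⟨_, rfl⟩
  have hlt : x < (b : ℝ) ^ (n + 1) := by
    have h := Int.lt_zpow_succ_log_self (by omega : 1 < b) x
    rw [← Real.floor_logb_natCast hx0.le, hn] at h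
    exact_mod_cast h
  have hlast : ⌈x / (b : ℝ) ^ (n + 1)⌉ = 1 := by
    rw [Int.ceil_eq_iff]
    refine ⟨?_, ?_⟩
    · have : 0 < x / (b : ℝ) ^ (n + 1) := by positivity
      simpa using this
    · rw [Int.cast_one]
      exact div_le_one_of_le₀ hlt.le (by positivity)
  simp only [sum_Ico_ceil_add_mul_pow_div b (by omega) x]
  rw [hn, Int.toNat_natCast, Finset.sum_add_distrib,
    Finset.sum_range_sub' (fun k => ⌈x / (b : ℝ) ^ k⌉), hlast]
  simp
  ring
end

section
/- Let b ≥ 2 be an integer and n ≥ 1 an integer with m = ⌊log_b n⌋. Then ∑_{k=0}^{m} ∑_{j=1}^{b−1} ⌈(n + j·b^k) / b^{k+1}⌉ = (b−1)(m + 1) + n − 1. -/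
/-- Hermite's identity for natural number division. -/
theorem sum_range_add_div (b q : ℕ) (hb : 0 < b) :
    ∑ j ∈ Finset.range b, (q + j) / b = q := by
  induction q with
  | zero =>
    refine Finset.sum_eq_zero fun j hj => ?_
    rw [zero_add, Nat.div_eq_of_lt (Finset.mem_range.mp hj)]
  | succ q ih =>
    have h := Finset.sum_range_succ (fun j => (q + j) / b) b
    rw [Finset.sum_range_succ', ih, Nat.add_div_right q hb] at h
    have hshift : ∀ j, (q + 1 + j) / b = (q + (j + 1)) / b := fun j => by
      rw [add_assoc, add_comm 1 j]
    simp only [hshift]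
    simp only [add_zero] at h
    omega

theorem div_add_sum_Ico_add_div (b q : ℕ) (hb : 0 < b) :
    q / b + ∑ j ∈ Finset.Ico 1 b, (q + j) / b = q := by
  have h := sum_range_add_div b q hb
  rwa [Finset.range_eq_Ico, Finset.sum_eq_sum_Ico_succ_bot hb, add_zero, zero_add] at h

theorem ceil_succ_div (a d : ℕ) (hd : 0 < d) :
    ⌈((a : ℚ) + 1) / d⌉ = ((a / d : ℕ) : ℤ) + 1 := by
  have hd' : (0 : ℚ) < d := by exact_mod_cast hd
  have hlow : d * (a / d) ≤ a := Nat.mul_div_le a d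
  have hupp : a + 1 ≤ d * (a / d + 1) := Nat.lt_mul_div_succ a hd
  generalize a / d = q at hlow hupp ⊢
  rw [Int.ceil_eq_iff]
  constructor
  · rw [lt_div_iff₀ hd']
    have : ((d * q : ℕ) : ℚ) ≤ a := by exact_mod_cast hlow
    push_cast at this ⊢
    linarith
  · rw [div_le_iff₀ hd']
    have : ((a + 1 : ℕ) : ℚ) ≤ (d * (q + 1) : ℕ) := by exact_mod_cast hupp
    push_cast at this ⊢
    linarith

theorem sum_ceil_succ_add_mul_pow_div (b N k : ℕ) (hb : 0 < b) :
    ∑ j ∈ Finset.Ico 1 b, ⌈(((N + 1 : ℕ) : ℚ) + j * b ^ k) / b ^ (k + 1)⌉ =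
      ((b : ℤ) - 1) + (((N / b ^ k : ℕ) : ℤ) - ((N / b ^ (k + 1) : ℕ) : ℤ)) := by
  have hterm : ∀ j : ℕ, ⌈(((N + 1 : ℕ) : ℚ) + j * b ^ k) / b ^ (k + 1)⌉ =
      (((N / b ^ k + j) / b : ℕ) : ℤ) + 1 := fun j => by
    have h := ceil_succ_div (N + j * b ^ k) (b ^ (k + 1)) (pow_pos hb _)
    rw [pow_succ, ← Nat.div_div_eq_div_mul, Nat.add_mul_div_right _ _ (pow_pos hb k)] at h
    rw [← h]
    push_cast
    congr 1
    ring
  have h := div_add_sum_Ico_add_div b (N / b ^ k) hb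
  rw [Nat.div_div_eq_div_mul, ← pow_succ] at h
  simp only [hterm, Finset.sum_add_distrib, Finset.sum_const, Nat.card_Ico, nsmul_eq_mul, mul_one]
  zify [Nat.succ_le_of_lt hb] at h ⊢
  linarith

/-- For an integer base `b ≥ 2` and an integer `n ≥ 1` with `m = ⌊log_b n⌋`,
`∑_{k=0}^{m} ∑_{j=1}^{b-1} ⌈(n + j·b^k)/b^(k+1)⌉ = (b−1)(m + 1) + n − 1`. -/
theorem ceil_double_sum (b n : ℕ) (hb : 2 ≤ b) (hn : 1 ≤ n) :
    ∑ k ∈ Finset.range (Nat.log b n + 1), ∑ j ∈ Finset.Ico 1 b,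
        ⌈((n : ℚ) + j * b ^ k) / b ^ (k + 1)⌉ =
      ((b : ℤ) - 1) * (Nat.log b n + 1) + n - 1 := by
  obtain ⟨N, rfl⟩ : ∃ N, n = N + 1 := ⟨n - 1, by omega⟩
  have hlt : N < b ^ (Nat.log b (N + 1) + 1) :=
    N.lt_succ_self.trans (Nat.lt_pow_succ_log_self hb (N + 1))
  rw [Finset.sum_congr rfl fun k _ => sum_ceil_succ_add_mul_pow_div b N k (by omega),
    Finset.sum_add_distrib, Finset.sum_range_sub' (fun k => ((N / b ^ k : ℕ) : ℤ)),
    Nat.div_eq_of_lt hlt]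
  simp only [Finset.sum_const, Finset.card_range, nsmul_eq_mul, pow_zero, Nat.div_one]
  push_cast
  ring
end

section
/- Let b ≥ 2 be an integer and n ≥ 1 an integer with m = ⌊log_b n⌋. Then ∑_{k=0}^{m} ∑_{j=1}^{b−1} ((n + j·b^k) / b^{k+1})) = 1/2 − n/b^{m+1}, where ((x)) denotes the sawtooth function equal to {x} − 1/2 when x is not an integer and equal to 0 when x is an integer. -/
/-- The sawtooth function `((x))`: equal to `{x} − 1/2` when `x` is not an integer
(i.e., when `{x} ≠ 0`) and equal to `0` when `x` is an integer. -/
def sawtooth (x : ℚ) : ℚ := if Int.fract x = 0 then 0 else Int.fract x - 1 / 2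

theorem sawtooth_periodic : Function.Periodic sawtooth 1 := by
  intro x
  simp [sawtooth]

theorem sawtooth_zero : sawtooth 0 = 0 := by simp [sawtooth]

theorem sawtooth_natCast (n : ℕ) : sawtooth n = 0 := by simp [sawtooth]

theorem sawtooth_of_pos_of_lt_one {x : ℚ} (h0 : 0 < x) (h1 : x < 1) :
    sawtooth x = x - 1 / 2 := by
  have h : Int.fract x = x := Int.fract_eq_self.2 ⟨h0.le, h1⟩
  simp [sawtooth, h, h0.ne']

/-- The distribution relation on the fundamental interval `[0, 1 / b)`. -/
theorem sum_sawtooth_add_div_of_mem_Ico {b : ℕ} (hb : 0 < b) {x : ℚ} (h0 : 0 ≤ x)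
    (h1 : b * x < 1) : ∑ j ∈ Finset.range b, sawtooth (x + j / b) = sawtooth (b * x) := by
  have hb' : (0 : ℚ) < b := by exact_mod_cast hb
  have gauss (c : ℕ) : ∑ j ∈ Finset.range c, (j : ℚ) = c * (c - 1) / 2 := by
    induction c with
    | zero => simp
    | succ c ih => rw [Finset.sum_range_succ, ih]; push_cast; ring
  have lt_one {j : ℕ} (hj : j < b) : x + j / b < 1 := by
    have hj' : (j : ℚ) + 1 ≤ b := by exact_mod_cast hj
    have : x + j / b = (b * x + j) / b := by field_simp
    rw [this, div_lt_one hb']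
    linarith
  rcases h0.eq_or_lt with rfl | hx
  · obtain ⟨c, rfl⟩ : ∃ c, b = c + 1 := ⟨b - 1, by omega⟩
    rw [Finset.sum_range_succ', Finset.sum_congr rfl (g := fun j : ℕ =>
      (j : ℚ) / (c + 1 : ℕ) + (1 / (c + 1 : ℕ) - 1 / 2))]
    · rw [Finset.sum_add_distrib, ← Finset.sum_div, gauss]
      simp only [Nat.cast_zero, zero_div, add_zero, mul_zero, sawtooth_zero, Finset.sum_const,
        Finset.card_range, nsmul_eq_mul]
      push_cast at hb' ⊢
      field_simp
      ring
    · intro j hj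
      have hj := Finset.mem_range.1 hj
      rw [sawtooth_of_pos_of_lt_one (by positivity) (lt_one (by omega))]
      push_cast
      ring
  · rw [Finset.sum_congr rfl (g := fun j : ℕ => (j : ℚ) / b + (x - 1 / 2)),
      sawtooth_of_pos_of_lt_one (by positivity) h1]
    · rw [Finset.sum_add_distrib, ← Finset.sum_div, gauss]
      simp only [Finset.sum_const, Finset.card_range, nsmul_eq_mul]
      field_simp
      ring
    · intro j hj
      rw [sawtooth_of_pos_of_lt_one (by positivity) (lt_one (Finset.mem_range.1 hj))]
      ring

/-- The distribution relation for the sawtooth function. -/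
theorem sum_sawtooth_add_div {b : ℕ} (hb : 0 < b) (x : ℚ) :
    ∑ j ∈ Finset.range b, sawtooth (x + j / b) = sawtooth (b * x) := by
  have hb' : (0 : ℚ) < b := by exact_mod_cast hb
  have left : Function.Periodic
      (fun y : ℚ => ∑ j ∈ Finset.range b, sawtooth (y + j / b)) (1 / b) := by
    intro y
    have shift := Finset.sum_range_succ' (fun j : ℕ => sawtooth (y + j / b)) b
    rw [Finset.sum_range_succ, div_self hb'.ne', sawtooth_periodic y] at shift
    simp only [Nat.cast_zero, zero_div, add_zero, add_left_inj] at shift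
    beta_reduce
    rw [shift]
    refine Finset.sum_congr rfl fun j _ => congrArg _ ?_
    push_cast
    ring
  have right : Function.Periodic (fun y : ℚ => sawtooth (b * y)) (1 / b) := by
    intro y
    have : (b : ℚ) * (y + 1 / b) = b * y + 1 := by field_simp
    simp only [this, sawtooth_periodic _]
  have hfract : (b : ℚ) * (x - ⌊b * x⌋ * (1 / b)) = Int.fract (b * x) := by
    rw [Int.fract]
    field_simp
  have base := sum_sawtooth_add_div_of_mem_Ico hb (x := x - ⌊b * x⌋ * (1 / b))
    (nonneg_of_mul_nonneg_right (hfract ▸ Int.fract_nonneg _) hb')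
    (hfract ▸ Int.fract_lt_one _)
  exact (left.sub_int_mul_eq _).symm.trans (base.trans (right.sub_int_mul_eq _))

/-- For an integer base `b ≥ 2` and an integer `n ≥ 1` with `m = ⌊log_b n⌋`,
`∑_{k=0}^{m} ∑_{j=1}^{b-1} ((n + j·b^k)/b^(k+1))) = 1/2 − n/b^(m+1)`. -/
theorem sawtooth_double_sum (b n : ℕ) (hb : 2 ≤ b) (hn : 1 ≤ n) :
    ∑ k ∈ Finset.range (Nat.log b n + 1), ∑ j ∈ Finset.Ico 1 b,
        sawtooth (((n : ℚ) + j * b ^ k) / b ^ (k + 1)) =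
      1 / 2 - (n : ℚ) / b ^ (Nat.log b n + 1) := by
  have hb' : (0 : ℚ) < b := by exact_mod_cast (by omega : 0 < b)
  have inner (k : ℕ) : ∑ j ∈ Finset.Ico 1 b, sawtooth (((n : ℚ) + j * b ^ k) / b ^ (k + 1)) =
      sawtooth (n / b ^ k) - sawtooth (n / b ^ (k + 1)) := by
    have dist := sum_sawtooth_add_div (by omega : 0 < b) ((n : ℚ) / b ^ (k + 1))
    rw [Finset.range_eq_Ico, Finset.sum_eq_sum_Ico_succ_bot (by omega)] at dist
    have hmul : (b : ℚ) * (n / b ^ (k + 1)) = n / b ^ k := by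
      field_simp
      ring
    simp only [Nat.cast_zero, zero_div, add_zero, zero_add, hmul] at dist
    rw [← dist, add_sub_cancel_left]
    refine Finset.sum_congr rfl fun j _ => congrArg _ ?_
    field_simp
    ring
  have hlt : (n : ℚ) < b ^ (Nat.log b n + 1) := by
    exact_mod_cast Nat.lt_pow_succ_log_self (by omega) n
  have hn' : (0 : ℚ) < n := by exact_mod_cast hn
  simp only [inner]
  rw [Finset.sum_range_sub', pow_zero, div_one, sawtooth_natCast,
    sawtooth_of_pos_of_lt_one (by positivity) ((div_lt_one (by positivity)).2 hlt)]
  ring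
end
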